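/- Let K be the attractor of an IFS of similitudes on a complete metric space, endowed with its natural fractal structure. Then F satisfies the level separation property (LSP) if and only if the natural fractal structure is a tiling. -/

import Mathlib

open scoped ENNReal

namespace IFSMoran

variable {X : Type*} [MetricSpace X]

/-- The map `f_i = f_{i1} o ... o f_{in}` associated to a word `i = i1...in`
(a list of indices). -/
def wMap {k : ℕ} (f : Fin k → X → X) : List (Fin k) → X → X
  | [] => id
  | i :: w => f i ∘ wMap f w

/-- The piece `A_i = f_i(K)` of the natural fractal structure. -/
def piece {k : ℕ} (f : Fin k → X → X) (K : Set X) (w : List (Fin k)) : Set X :=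
  wMap f w '' K

/-- The natural fractal structure (levels indexed by words) is irreducible:
no level admits a proper subcovering. -/
def Irred {k : ℕ} (f : Fin k → X → X) (K : Set X) : Prop :=
  ∀ w : List (Fin k),
    ¬ piece f K w ⊆ ⋃ v ∈ {v : List (Fin k) | v.length = w.length ∧ v ≠ w}, piece f K v

/-- `H³ₙˢ(K) = inf_{l ≥ n} ∑_{i ∈ Σˡ} diam (A_i) ^ s`. -/
noncomputable def H3n {k : ℕ} (f : Fin k → X → X) (K : Set X) (s : ℝ) (n : ℕ) : ℝ≥0∞ :=
  ⨅ (l : ℕ) (_ : n ≤ l),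
    ∑ w : Fin l → Fin k, EMetric.diam (piece f K (List.ofFn w)) ^ s

/-- `H³ˢ(K) = lim_n H³ₙˢ(K)`; the sequence is nondecreasing in `n`, so the limit
is the supremum. -/
noncomputable def H3 {k : ℕ} (f : Fin k → X → X) (K : Set X) (s : ℝ) : ℝ≥0∞ :=
  ⨆ n, H3n f K s n

/-- Fractal dimension III: `dim³(K) = inf {s ≥ 0 : H³ˢ(K) = 0}`. -/
noncomputable def dim3 {k : ℕ} (f : Fin k → X → X) (K : Set X) : ℝ :=
  sInf {s : ℝ | 0 ≤ s ∧ H3 f K s = 0}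

/-- `H⁴ₙˢ(K)`: infimum of `∑ diam (A_i) ^ s` over finite coverings of `K` by
pieces indexed by words of length `≥ n`. -/
noncomputable def H4n {k : ℕ} (f : Fin k → X → X) (K : Set X) (s : ℝ) (n : ℕ) : ℝ≥0∞ :=
  ⨅ (𝒜 : Finset (List (Fin k))) (_ : ∀ w ∈ 𝒜, n ≤ w.length)
      (_ : K ⊆ ⋃ w ∈ 𝒜, piece f K w),
    ∑ w ∈ 𝒜, EMetric.diam (piece f K w) ^ s

/-- `H⁴ˢ(K) = lim_n H⁴ₙˢ(K)`; the sequence is nondecreasing in `n`, so the limit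
is the supremum. -/
noncomputable def H4 {k : ℕ} (f : Fin k → X → X) (K : Set X) (s : ℝ) : ℝ≥0∞ :=
  ⨆ n, H4n f K s n

/-- Fractal dimension IV: `dim⁴(K) = inf {s ≥ 0 : H⁴ˢ(K) = 0}`. -/
noncomputable def dim4 {k : ℕ} (f : Fin k → X → X) (K : Set X) : ℝ :=
  sInf {s : ℝ | 0 ≤ s ∧ H4 f K s = 0}

/-- Interior of `A` relative to `K` (as a subset of the ambient space `X`). -/
def intK (K A : Set X) : Set X := K \ closure (K \ A)

/-- The level separation property: interiors (in `K`) of two pieces indexed by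
distinct words of the same length are disjoint (LSP1), and every piece has
nonempty interior in `K` (LSP2). -/
def LSP {k : ℕ} (f : Fin k → X → X) (K : Set X) : Prop :=
  (∀ v w : List (Fin k), v.length = w.length → v ≠ w →
      intK K (piece f K v) ∩ intK K (piece f K w) = ∅) ∧
  ∀ w : List (Fin k), (intK K (piece f K w)).Nonempty

/-- The natural fractal structure is a tiling: pieces indexed by distinct words
of the same length have disjoint interiors in `K`, and every piece is regularly
closed in `K`, i.e. `cl_K (int_K (A_i)) = A_i`. -/
def IsTiling {k : ℕ} (f : Fin k → X → X) (K : Set X) : Prop :=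
  (∀ v w : List (Fin k), v.length = w.length → v ≠ w →
      intK K (piece f K v) ∩ intK K (piece f K w) = ∅) ∧
  ∀ w : List (Fin k), closure (intK K (piece f K w)) ∩ K = piece f K w


lemma intK_subset (K A : Set X) : intK K A ⊆ A := by
  rintro x ⟨hxK, hx⟩
  by_contra hxA
  exact hx (subset_closure ⟨hxK, hxA⟩)

lemma intK_mono (K : Set X) {A B : Set X} (h : A ⊆ B) : intK K A ⊆ intK K B :=
  Set.sdiff_subset_sdiff_right (closure_mono (Set.sdiff_subset_sdiff_right h))

omit [MetricSpace X] in
lemma wMap_append {k : ℕ} (f : Fin k → X → X) (w u : List (Fin k)) (x : X) :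
    wMap f (w ++ u) x = wMap f w (wMap f u x) := by
  induction w with
  | nil => rfl
  | cons i w ih => simp [wMap, ih]

lemma dist_wMap_le {k : ℕ} {f : Fin k → X → X} {r : ℝ} (hr : 0 ≤ r)
    (hf : ∀ i x y, dist (f i x) (f i y) ≤ r * dist x y) (w : List (Fin k)) (x y : X) :
    dist (wMap f w x) (wMap f w y) ≤ r ^ w.length * dist x y := by
  induction w with
  | nil => simp [wMap]
  | cons i w ih =>
    calc dist (f i (wMap f w x)) (f i (wMap f w y))
        ≤ r * dist (wMap f w x) (wMap f w y) := hf i _ _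
      _ ≤ r * (r ^ w.length * dist x y) := mul_le_mul_of_nonneg_left ih hr
      _ = r ^ (i :: w).length * dist x y := by rw [List.length_cons, pow_succ]; ring

omit [MetricSpace X] in
lemma piece_subset {k : ℕ} {f : Fin k → X → X} {K : Set X} (hK : K = ⋃ i, f i '' K)
    (w : List (Fin k)) : piece f K w ⊆ K := by
  rintro _ ⟨x, hx, rfl⟩
  induction w with
  | nil => exact hx
  | cons i w ih =>
    rw [hK]
    exact Set.mem_iUnion.2 ⟨i, _, ih, rfl⟩

omit [MetricSpace X] in
lemma piece_append_subset {k : ℕ} {f : Fin k → X → X} {K : Set X} (hK : K = ⋃ i, f i '' K)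
    (w u : List (Fin k)) : piece f K (w ++ u) ⊆ piece f K w := by
  rintro _ ⟨x, hx, rfl⟩
  exact ⟨wMap f u x, piece_subset hK u ⟨x, hx, rfl⟩, (wMap_append f w u x).symm⟩

omit [MetricSpace X] in
lemma exists_mem_piece {k : ℕ} {f : Fin k → X → X} {K : Set X} (hK : K = ⋃ i, f i '' K)
    (n : ℕ) {x : X} (hx : x ∈ K) : ∃ u : List (Fin k), u.length = n ∧ x ∈ piece f K u := by
  induction n generalizing x with
  | zero => exact ⟨[], rfl, x, hx, rfl⟩
  | succ n ih =>
    rw [hK] at hx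
    obtain ⟨i, y, hy, rfl⟩ := Set.mem_iUnion.1 hx
    obtain ⟨u, hu, z, hz, rfl⟩ := ih hy
    exact ⟨i :: u, by simp [hu], z, hz, rfl⟩

/-- If all pieces have nonempty interior in `K`, then the interior of every piece is dense
in it, because small subpieces accumulate at each of its points. -/
lemma piece_subset_closure_intK {k : ℕ} {f : Fin k → X → X} {K : Set X} {r : ℝ} (hr : 0 ≤ r)
    (hr1 : r < 1) (hf : ∀ i x y, dist (f i x) (f i y) ≤ r * dist x y)
    (hKb : Bornology.IsBounded K) (hK : K = ⋃ i, f i '' K)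
    (hne : ∀ w : List (Fin k), (intK K (piece f K w)).Nonempty) (w : List (Fin k)) :
    piece f K w ⊆ closure (intK K (piece f K w)) := by
  rintro _ ⟨y, hy, rfl⟩
  rw [Metric.mem_closure_iff]
  intro ε hε
  have hD : 0 < Metric.diam K + 1 := by linarith [Metric.diam_nonneg (s := K)]
  obtain ⟨n, hn⟩ := exists_pow_lt_of_lt_one (div_pos hε hD) hr1
  obtain ⟨u, hu, z, hz, rfl⟩ := exists_mem_piece hK n hy
  obtain ⟨b, hb⟩ := hne (w ++ u)
  obtain ⟨t, ht, rfl⟩ := intK_subset K _ hb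
  refine ⟨_, intK_mono K (piece_append_subset hK w u) hb, ?_⟩
  rw [← wMap_append]
  calc dist (wMap f (w ++ u) z) (wMap f (w ++ u) t)
      ≤ r ^ (w ++ u).length * dist z t := dist_wMap_le hr hf _ _ _
    _ ≤ r ^ n * (Metric.diam K + 1) := by
      have hpow : r ^ (w ++ u).length ≤ r ^ n :=
        pow_le_pow_of_le_one hr hr1.le (by simp [hu])
      have hdist := Metric.dist_le_diam_of_mem hKb hz ht
      exact mul_le_mul hpow (by linarith) dist_nonneg (pow_nonneg hr n)
    _ < ε := (lt_div_iff₀ hD).1 hn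

theorem stmt_12 {X : Type*} [MetricSpace X] [CompleteSpace X]
    {k : ℕ} (hk : 2 ≤ k) (f : Fin k → X → X) (c : Fin k → ℝ)
    (hc : ∀ i, c i ∈ Set.Ioo (0 : ℝ) 1)
    (hf : ∀ i x y, dist (f i x) (f i y) = c i * dist x y)
    (K : Set X) (hKne : K.Nonempty) (hKcp : IsCompact K)
    (hK : K = ⋃ i, f i '' K) :
    LSP f K ↔ IsTiling f K := by
  have : Nonempty (Fin k) := ⟨⟨0, by omega⟩⟩
  obtain ⟨j, hj⟩ := Finite.exists_max c
  have hfj : ∀ i x y, dist (f i x) (f i y) ≤ c j * dist x y := fun i x y =>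
    (hf i x y).trans_le (mul_le_mul_of_nonneg_right (hj i) dist_nonneg)
  have hclosed : ∀ w, IsClosed (piece f K w) := fun w =>
    (hKcp.image (LipschitzWith.of_dist_le_mul
      (K := ⟨c j ^ w.length, pow_nonneg (hc j).1.le _⟩)
      (dist_wMap_le (hc j).1.le hfj w)).continuous).isClosed
  refine and_congr_right fun _ => ⟨fun hne w => ?_, fun hreg w => ?_⟩
  · exact Set.Subset.antisymm
      (Set.inter_subset_left.trans (closure_minimal (intK_subset K _) (hclosed w)))
      (Set.subset_inter (piece_subset_closure_intK (hc j).1.le (hc j).2 hfj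
        hKcp.isBounded hK hne w) (piece_subset hK w))
  · have hw : (piece f K w).Nonempty := hKne.image _
    rw [← hreg w] at hw
    exact closure_nonempty_iff.1 hw.left

end IFSMoran
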